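/- arXiv:1408.3842 — 2 statements merged into one kernel-verified Lean document; each statement's English description precedes it below -/
import Mathlib

section
/- Let X be a topological space, φ a continuous semiflow on X, and S : X → ℝ a Lyapunov function for φ. Fix c ∈ ℝ, ε > 0, τ > 0. Let γ ∈ X satisfy S(γ) < c+ε, and suppose there is a real number T* > 2τ such that S(φ_s γ) > c−ε for all s ∈ [0, T*) and S(φ_s γ) ≤ c−ε for all s ≥ T* (i.e. T* is the first time the trajectory of γ reaches the action level c−ε). Then for every s ≥ 0: (a) φ_s γ ∈ N_c^{ε,τ} if and only if s < T* − τ; and (b) φ_s γ ∈ L_c^{ε,τ} if and only if T* − 2τ ≤ s < T* − τ. Consequently the trajectory of γ leaves N_c^{ε,τ} exactly through L_c^{ε,τ}: setting a := T* − 2τ and b := T* − τ, one has φ_σ γ ∈ L_c^{ε,τ} and φ_s γ ∈ N_c^{ε,τ} for all σ ∈ [a,b) and s ∈ [0,σ]. -/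
/-- A continuous semiflow on a topological space `X`. -/
def IsSemiflow {X : Type*} [TopologicalSpace X] (φ : ℝ → X → X) : Prop :=
  ContinuousOn (fun p : ℝ × X => φ p.1 p.2) (Set.Ici (0 : ℝ) ×ˢ Set.univ) ∧
  (∀ γ, φ 0 γ = γ) ∧
  ∀ s t : ℝ, 0 ≤ s → 0 ≤ t → ∀ γ, φ s (φ t γ) = φ (s + t) γ

/-- The set `N_c^{ε,τ} = {γ | S γ < c + ε ∧ S (φ_τ γ) > c - ε}`. -/
def Nset {X : Type*} [TopologicalSpace X] (φ : ℝ → X → X) (S : X → ℝ)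
    (c ε τ : ℝ) : Set X :=
  {γ : X | S γ < c + ε ∧ c - ε < S (φ τ γ)}

/-- The set `L_c^{ε,τ} = {γ ∈ N_c^{ε,τ} | S (φ_{2τ} γ) ≤ c - ε}`. -/
def Lset {X : Type*} [TopologicalSpace X] (φ : ℝ → X → X) (S : X → ℝ)
    (c ε τ : ℝ) : Set X :=
  {γ ∈ Nset φ S c ε τ | S (φ (2 * τ) γ) ≤ c - ε}

/-- if the trajectory of `γ` (with `S γ < c + ε`) first reaches
the level `c - ε` at time `T* > 2τ`, then for every `s ≥ 0` one has
`φ_s γ ∈ N_c^{ε,τ}` iff `s < T* - τ`, and `φ_s γ ∈ L_c^{ε,τ}` iff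
`T* - 2τ ≤ s < T* - τ`; consequently, with `a = T* - 2τ` and `b = T* - τ`,
the trajectory leaves `N` exactly through `L`. -/
theorem trajectory_leaves_Nset_through_Lset
    {X : Type*} [TopologicalSpace X] (φ : ℝ → X → X) (S : X → ℝ)
    (hφ : IsSemiflow φ)
    (hLyap : ∀ s : ℝ, 0 ≤ s → ∀ γ, S (φ s γ) ≤ S γ)
    (c ε τ : ℝ) (hε : 0 < ε) (hτ : 0 < τ)
    (γ : X) (hγ : S γ < c + ε) (Tstar : ℝ) (hTstar : 2 * τ < Tstar)
    (hbefore : ∀ s : ℝ, 0 ≤ s → s < Tstar → c - ε < S (φ s γ))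
    (hafter : ∀ s : ℝ, Tstar ≤ s → S (φ s γ) ≤ c - ε) :
    (∀ s : ℝ, 0 ≤ s →
      ((φ s γ ∈ Nset φ S c ε τ ↔ s < Tstar - τ) ∧
       (φ s γ ∈ Lset φ S c ε τ ↔ Tstar - 2 * τ ≤ s ∧ s < Tstar - τ))) ∧
    ∀ σ : ℝ, Tstar - 2 * τ ≤ σ → σ < Tstar - τ →
      φ σ γ ∈ Lset φ S c ε τ ∧
      ∀ s : ℝ, 0 ≤ s → s ≤ σ → φ s γ ∈ Nset φ S c ε τ := by
  have above_iff : ∀ s : ℝ, 0 ≤ s → (c - ε < S (φ s γ) ↔ s < Tstar) := fun s hs =>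
    ⟨fun h => lt_of_not_ge fun hle => (hafter s hle).not_gt h, hbefore s hs⟩
  have mem_Nset_iff : ∀ s : ℝ, 0 ≤ s → (φ s γ ∈ Nset φ S c ε τ ↔ s < Tstar - τ) := by
    intro s hs
    have hlt : S (φ s γ) < c + ε := (hLyap s hs γ).trans_lt hγ
    simp only [Nset, Set.mem_ofPred_eq, hlt, true_and]
    rw [hφ.2.2 τ s hτ.le hs, above_iff (τ + s) (by positivity), lt_sub_iff_add_lt']
  have mem_Lset_iff : ∀ s : ℝ, 0 ≤ s →
      (φ s γ ∈ Lset φ S c ε τ ↔ Tstar - 2 * τ ≤ s ∧ s < Tstar - τ) := by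
    intro s hs
    simp only [Lset, Set.mem_ofPred_eq]
    rw [mem_Nset_iff s hs, hφ.2.2 (2 * τ) s (by positivity) hs, ← not_lt,
      above_iff (2 * τ + s) (by positivity), not_lt, sub_le_iff_le_add', and_comm]
  refine ⟨fun s hs => ⟨mem_Nset_iff s hs, mem_Lset_iff s hs⟩, fun σ hσ hσ' => ⟨?_, ?_⟩⟩
  · exact (mem_Lset_iff σ ((sub_pos.2 hTstar).le.trans hσ)).2 ⟨hσ, hσ'⟩
  · exact fun s hs hsσ => (mem_Nset_iff s hs).2 (hsσ.trans_lt hσ')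
end

section
/- Let X be a topological space and φ a continuous semiflow on X. Let A ⊆ X be semiflow invariant, let N ⊆ X, and let L ⊆ N satisfy L ⊆ A together with the exit-set property: for every γ ∈ N and every s ≥ 0 with φ_s γ ∉ N there exists σ ∈ (0,s) such that φ_σ γ ∈ L and φ_r γ ∈ N for all r ∈ [0,σ]. Then the union N ∪ A is semiflow invariant. Moreover, for every T ≥ 0 the preimage φ_T^{-1}(N ∪ A) is semiflow invariant, and it is open whenever N and A are open. -/
theorem IsSemiflow.continuous_time {X : Type*} [TopologicalSpace X] {φ : ℝ → X → X}
    (hφ : IsSemiflow φ) {T : ℝ} (hT : 0 ≤ T) : Continuous (φ T) :=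
  hφ.1.comp_continuous (f := fun γ : X => (T, γ)) (by fun_prop) fun _ => ⟨hT, Set.mem_univ _⟩

theorem IsSemiflow.comm {X : Type*} [TopologicalSpace X] {φ : ℝ → X → X}
    (hφ : IsSemiflow φ) {s t : ℝ} (hs : 0 ≤ s) (ht : 0 ≤ t) (γ : X) :
    φ s (φ t γ) = φ t (φ s γ) := by
  rw [hφ.2.2 s t hs ht, hφ.2.2 t s ht hs, add_comm]

/-- if `A` is semiflow invariant and `L ⊆ N` satisfies `L ⊆ A`
together with the exit-set property, then `N ∪ A` is semiflow invariant;
moreover every preimage `φ_T⁻¹(N ∪ A)` (`T ≥ 0`) is semiflow invariant, and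
it is open whenever `N` and `A` are open. -/
theorem union_and_preimage_semiflowInvariant
    {X : Type*} [TopologicalSpace X] (φ : ℝ → X → X)
    (hφ : IsSemiflow φ) (A N L : Set X)
    (hA : ∀ s : ℝ, 0 ≤ s → ∀ a ∈ A, φ s a ∈ A)
    (hLN : L ⊆ N) (hLA : L ⊆ A)
    (hexit : ∀ γ ∈ N, ∀ s : ℝ, 0 ≤ s → φ s γ ∉ N →
      ∃ σ : ℝ, 0 < σ ∧ σ < s ∧ φ σ γ ∈ L ∧
        ∀ r : ℝ, 0 ≤ r → r ≤ σ → φ r γ ∈ N) :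
    (∀ s : ℝ, 0 ≤ s → ∀ γ ∈ N ∪ A, φ s γ ∈ N ∪ A) ∧
    ∀ T : ℝ, 0 ≤ T →
      (∀ s : ℝ, 0 ≤ s → ∀ γ ∈ (φ T) ⁻¹' (N ∪ A), φ s γ ∈ (φ T) ⁻¹' (N ∪ A)) ∧
      (IsOpen N → IsOpen A → IsOpen ((φ T) ⁻¹' (N ∪ A))) := by
  have hinv : ∀ s : ℝ, 0 ≤ s → ∀ γ ∈ N ∪ A, φ s γ ∈ N ∪ A := by
    rintro s hs γ (hγ | hγ)
    · by_cases hN : φ s γ ∈ N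
      · exact Or.inl hN
      · obtain ⟨σ, hσ, hσs, hL, -⟩ := hexit γ hγ s hs hN
        have h := hA (s - σ) (sub_nonneg.2 hσs.le) _ (hLA hL)
        rw [hφ.2.2 _ _ (sub_nonneg.2 hσs.le) hσ.le, sub_add_cancel] at h
        exact Or.inr h
    · exact Or.inr (hA s hs γ hγ)
  refine ⟨hinv, fun T hT => ⟨fun s hs γ hγ => ?_, fun hN hAo =>
    (hN.union hAo).preimage (hφ.continuous_time hT)⟩⟩
  rw [Set.mem_preimage, hφ.comm hT hs]
  exact hinv s hs _ hγ
end
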